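/- For every ρ ∈ [0,1], the set H(ρ) is Lebesgue measurable and its Lebesgue measure satisfies λ(H(ρ)) = 1 if ρ < 1/2 and λ(H(ρ)) = 0 if ρ ≥ 1/2. -/

import Mathlib

open Filter Set MeasureTheory

noncomputable section

/-- `g_0(z) = 2z - z²` (bit `false`), `g_1(z) = z²` (bit `true`). -/
def gBit (c : Bool) (z : ℝ) : ℝ := if c then z ^ 2 else 2 * z - z ^ 2

/-- `pPre b n z = g_{b_n}(g_{b_{n-1}}(⋯ g_{b_1}(z) ⋯))`, where `b_i` is `b (i-1)`. -/
def pPre (b : ℕ → Bool) : ℕ → ℝ → ℝ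
  | 0, z => z
  | n + 1, z => gBit (b n) (pPre b n z)

/-- `f(b) = Σ_{n ≥ 1} b_n 2^{-n}`. -/
def fBin (b : ℕ → Bool) : ℝ := ∑' n : ℕ, (if b n then (1 : ℝ) else 0) / 2 ^ (n + 1)

/-- The dyadic rationals in `[0,1]`. -/
def dyadics : Set ℝ := Set.Icc 0 1 ∩ {x : ℝ | ∃ (p : ℤ) (n : ℕ), x = (p : ℝ) / 2 ^ n}

/-- The good channels of a BEC with erasure probability `ε`: `x ∈ [0,1]` such that some binary
expansion `b` of `x` satisfies `p_{b^n}(ε) → 0`. -/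
def Gset (ε : ℝ) : Set ℝ :=
  {x : ℝ | ∃ b : ℕ → Bool, fBin b = x ∧ Tendsto (fun n => pPre b n ε) atTop (nhds 0)}

/-- The bad channels of a BEC with erasure probability `ε`: `x ∈ [0,1]` such that some binary
expansion `b` of `x` satisfies `p_{b^n}(ε) → 1`. -/
def Bset (ε : ℝ) : Set ℝ :=
  {x : ℝ | ∃ b : ℕ → Bool, fBin b = x ∧ Tendsto (fun n => pPre b n ε) atTop (nhds 1)}

/-- Hamming weight `w(b^n)` of the length-`n` prefix of `b`. -/
def wPre (b : ℕ → Bool) (n : ℕ) : ℕ := ∑ i ∈ Finset.range n, (if b i then 1 else 0)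

/-- `b` is `ρ`-heavy: `liminf_{n→∞} (w(b^n) - nρ) ≥ 0` (the liminf computed in `EReal`),
equivalently `liminf 2^{w(b^n)} / 2^{nρ} ≥ 1`. -/
def Heavy (ρ : ℝ) (b : ℕ → Bool) : Prop :=
  0 ≤ atTop.liminf (fun n : ℕ => (((wPre b n : ℝ) - n * ρ : ℝ) : EReal))

/-- The set of `ρ`-heavy channels. -/
def Hset (ρ : ℝ) : Set ℝ := {x : ℝ | ∃ b : ℕ → Bool, fBin b = x ∧ Heavy ρ b}

open ProbabilityTheory Topology

/-- Prepend a bit to a binary sequence. -/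
def consBit (c : Bool) (b : ℕ → Bool) : ℕ → Bool
  | 0 => c
  | n + 1 => b n

lemma measurable_consBit (c : Bool) : Measurable (consBit c) := by
  refine measurable_pi_lambda _ fun n => ?_
  cases n with
  | zero => exact measurable_const
  | succ n => exact measurable_pi_apply n

/-- The law of a fair bit. -/
def fairBit : Measure Bool := (2⁻¹ : ENNReal) • (Measure.dirac false + Measure.dirac true)

instance : IsProbabilityMeasure fairBit :=
  ⟨by simp [fairBit, ENNReal.inv_two_add_inv_two]⟩

/-- The law of a sequence of independent fair bits. -/
def fairCoin : Measure (ℕ → Bool) := Measure.infinitePi fun _ => fairBit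

instance : IsProbabilityMeasure fairCoin := by unfold fairCoin; infer_instance

lemma fairCoin_preimage_consBit (c : Bool) (N : ℕ) (t : ℕ → Set Bool) :
    fairCoin (consBit c ⁻¹' Set.pi (Finset.range (N + 1)) t) =
      Measure.dirac c (t 0) * ∏ i ∈ Finset.range N, fairBit (t (i + 1)) := by
  by_cases hc : c ∈ t 0
  · have : consBit c ⁻¹' Set.pi (Finset.range (N + 1)) t =
        Set.pi (Finset.range N) fun i => t (i + 1) := by
      ext b
      simp only [Set.mem_preimage, Set.mem_pi, Finset.coe_range, Set.mem_Iio]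
      refine ⟨fun h i hi => h (i + 1) (by omega), fun h i hi => ?_⟩
      cases i with
      | zero => exact hc
      | succ i => exact h i (by omega)
    rw [this, fairCoin, Measure.infinitePi_pi _ fun _ _ => MeasurableSet.of_discrete]
    simp [hc]
  · have : consBit c ⁻¹' Set.pi (Finset.range (N + 1)) t = ∅ := by
      ext b
      simp only [Set.mem_preimage, Set.mem_pi, Finset.coe_range, Set.mem_Iio,
        Set.mem_empty_iff_false, iff_false]
      exact fun h => hc (h 0 (by omega))
    rw [this]
    simp [hc]

lemma fairCoin_eq_map_consBit :
    (2⁻¹ : ENNReal) • (fairCoin.map (consBit false) + fairCoin.map (consBit true)) =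
      fairCoin := by
  classical
  refine Measure.eq_infinitePi _ fun s t ht => ?_
  obtain ⟨N, hN⟩ := s.exists_nat_subset_range
  have hN' : s ⊆ Finset.range (N + 1) := hN.trans (Finset.range_mono (by omega))
  set u : ℕ → Set Bool := fun i => if i ∈ s then t i else Set.univ with hu
  have hpi : Set.pi (s : Set ℕ) t = Set.pi (Finset.range (N + 1) : Finset ℕ) u := by
    ext b
    simp only [Set.mem_pi, hu, Finset.mem_coe]
    refine ⟨fun h i _ => ?_, fun h i hi => by simpa [hi] using h i (hN' hi)⟩
    split_ifs with his
    · exact h i his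
    · trivial
  have hprod : ∏ i ∈ s, fairBit (t i) = ∏ i ∈ Finset.range (N + 1), fairBit (u i) := by
    rw [← Finset.prod_subset hN' fun i _ hi => by simp only [hu, hi, if_false, measure_univ]]
    exact Finset.prod_congr rfl fun i hi => by simp [hu, hi]
  have hm : MeasurableSet (Set.pi (Finset.range (N + 1) : Finset ℕ) u) :=
    MeasurableSet.pi (Finset.countable_toSet _) fun _ _ => MeasurableSet.of_discrete
  rw [hpi, hprod, Finset.prod_range_succ', Measure.smul_apply, Measure.add_apply,
    Measure.map_apply (measurable_consBit _) hm, Measure.map_apply (measurable_consBit _) hm,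
    fairCoin_preimage_consBit, fairCoin_preimage_consBit, ← add_mul]
  simp only [fairBit, Measure.smul_apply, Measure.add_apply, smul_eq_mul]
  ring

lemma summable_fBin (b : ℕ → Bool) :
    Summable fun n : ℕ => (if b n then (1 : ℝ) else 0) / 2 ^ (n + 1) := by
  refine Summable.of_nonneg_of_le (fun n => by positivity) (fun n => ?_)
    (summable_geometric_two' 1)
  rw [pow_succ', ← div_div]
  gcongr
  split_ifs <;> norm_num

lemma fBin_nonneg (b : ℕ → Bool) : 0 ≤ fBin b := tsum_nonneg fun n => by positivity

lemma fBin_le_one (b : ℕ → Bool) : fBin b ≤ 1 := by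
  rw [← tsum_geometric_two' 1]
  refine (summable_fBin b).tsum_le_tsum (fun n => ?_) (summable_geometric_two' 1)
  rw [pow_succ', ← div_div]
  gcongr
  split_ifs <;> norm_num

lemma continuous_fBin : Continuous fBin := by
  refine continuous_tsum (u := fun n => 1 / 2 / 2 ^ n) (fun n => ?_)
    (summable_geometric_two' 1) fun n b => ?_
  · exact (continuous_of_discreteTopology (f := fun c : Bool => if c then (1 : ℝ) else 0)).comp
      (continuous_apply n) |>.div_const _
  · rw [Real.norm_of_nonneg (by positivity), pow_succ', ← div_div]
    gcongr
    split_ifs <;> norm_num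

lemma fBin_eq_head_tail (b : ℕ → Bool) :
    fBin b = ((if b 0 then (1 : ℝ) else 0) + fBin fun n => b (n + 1)) / 2 := by
  rw [fBin, (summable_fBin b).tsum_eq_zero_add, fBin, add_div, ← tsum_div_const]
  congr 1
  · simp
  · refine tsum_congr fun n => ?_
    rw [div_div, ← pow_succ]

lemma fBin_consBit (c : Bool) (b : ℕ → Bool) :
    fBin (consBit c b) = ((if c then (1 : ℝ) else 0) + fBin b) / 2 := fBin_eq_head_tail _

lemma fairCoin_real_fBin_le (x : ℝ) :
    fairCoin.real {b | fBin b ≤ x} =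
      (fairCoin.real {b | fBin b ≤ 2 * x} + fairCoin.real {b | fBin b ≤ 2 * x - 1}) / 2 := by
  have hm : MeasurableSet {b | fBin b ≤ x} :=
    measurableSet_le continuous_fBin.measurable measurable_const
  conv_lhs => rw [← fairCoin_eq_map_consBit]
  have h0 : consBit false ⁻¹' {b | fBin b ≤ x} = {b | fBin b ≤ 2 * x} := by
    ext b
    simp only [Set.mem_preimage, Set.mem_ofPred_eq, fBin_consBit]
    constructor <;> intro h <;> norm_num at * <;> linarith
  have h1 : consBit true ⁻¹' {b | fBin b ≤ x} = {b | fBin b ≤ 2 * x - 1} := by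
    ext b
    simp only [Set.mem_preimage, Set.mem_ofPred_eq, fBin_consBit]
    constructor <;> intro h <;> norm_num at * <;> linarith
  rw [Measure.real, Measure.smul_apply, Measure.add_apply,
    Measure.map_apply (measurable_consBit _) hm, Measure.map_apply (measurable_consBit _) hm,
    h0, h1, smul_eq_mul, ENNReal.toReal_mul, ENNReal.toReal_add (by finiteness) (by finiteness)]
  simp [Measure.real]
  ring

lemma fairCoin_real_fBin_le_eq (x : ℝ) :
    fairCoin.real {b | fBin b ≤ x} = max 0 (min x 1) := by
  have hneg : ∀ y < 0, fairCoin.real {b | fBin b ≤ y} = 0 := fun y hy => by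
    have : {b | fBin b ≤ y} = ∅ :=
      Set.eq_empty_of_forall_notMem fun b hb => (hb.trans_lt hy).not_ge (fBin_nonneg b)
    simp [this]
  have hone : ∀ y ≥ 1, fairCoin.real {b | fBin b ≤ y} = 1 := fun y hy => by
    have : {b | fBin b ≤ y} = Set.univ := Set.eq_univ_of_forall fun b => (fBin_le_one b).trans hy
    simp [this]
  have hbound : ∀ n : ℕ, ∀ y : ℝ,
      |fairCoin.real {b | fBin b ≤ y} - max 0 (min y 1)| ≤ (1 / 2) ^ n := by
    intro n
    induction n with
    | zero =>
      intro y
      have h0 : 0 ≤ fairCoin.real {b | fBin b ≤ y} := measureReal_nonneg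
      have h1 : fairCoin.real {b | fBin b ≤ y} ≤ 1 := measureReal_le_one
      have h2 : 0 ≤ max 0 (min y 1) := le_max_left _ _
      have h3 : max 0 (min y 1) ≤ 1 := max_le zero_le_one (min_le_right _ _)
      rw [pow_zero, abs_le]
      constructor <;> linarith
    | succ n ih =>
      intro y
      rw [fairCoin_real_fBin_le, pow_succ]
      rcases lt_or_ge y (1 / 2) with hy | hy
      · have := abs_le.1 (ih (2 * y))
        rw [hneg (2 * y - 1) (by linarith), abs_le]
        grind
      · have := abs_le.1 (ih (2 * y - 1))
        rw [hone (2 * y) (by linarith), abs_le]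
        grind
  have hlim : Tendsto (fun n : ℕ => (1 / 2 : ℝ) ^ n) atTop (𝓝 0) :=
    tendsto_pow_atTop_nhds_zero_of_lt_one (by norm_num) (by norm_num)
  have := ge_of_tendsto' hlim fun n => hbound n x
  exact sub_eq_zero.1 (abs_nonpos_iff.1 this)

lemma map_fBin_fairCoin : fairCoin.map fBin = volume.restrict (Set.Icc (0 : ℝ) 1) := by
  have : IsProbabilityMeasure (fairCoin.map fBin) :=
    Measure.isProbabilityMeasure_map continuous_fBin.measurable.aemeasurable
  have : IsProbabilityMeasure (volume.restrict (Set.Icc (0 : ℝ) 1)) := ⟨by simp⟩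
  refine Measure.eq_of_cdf _ _ (StieltjesFunction.ext fun x => ?_)
  rw [cdf_eq_real, cdf_eq_real, map_measureReal_apply continuous_fBin.measurable measurableSet_Iic,
    measureReal_restrict_apply measurableSet_Iic]
  refine (fairCoin_real_fBin_le_eq x).trans ?_
  have : Set.Iic x ∩ Set.Icc 0 1 = Set.Icc 0 (min x 1) := by
    ext y
    simp only [Set.mem_inter_iff, Set.mem_Iic, Set.mem_Icc, le_min_iff]
    tauto
  rw [this, Measure.real, Real.volume_Icc, ENNReal.toReal_ofReal', sub_zero, max_comm]

lemma volume_eq_fairCoin_preimage {A : Set ℝ} (hA : MeasurableSet A) (h01 : A ⊆ Set.Icc 0 1) :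
    volume A = fairCoin (fBin ⁻¹' A) := by
  rw [← Measure.map_apply continuous_fBin.measurable hA, map_fBin_fairCoin,
    Measure.restrict_apply hA, Set.inter_eq_left.2 h01]

/-- The sequences that are eventually `true`. -/
def EventuallyTrue : Set (ℕ → Bool) := {b | ∃ n, ∀ k ≥ n, b k = true}

lemma countable_eventuallyTrue : EventuallyTrue.Countable := by
  have : EventuallyTrue ⊆ ⋃ n : ℕ, Set.range fun (c : Fin n → Bool) (k : ℕ) =>
      if h : k < n then c ⟨k, h⟩ else true := by
    rintro b ⟨n, hn⟩
    refine Set.mem_iUnion.2 ⟨n, fun k => b k, funext fun k => ?_⟩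
    by_cases h : k < n
    · simp [h]
    · simp [h, hn k (by omega)]
  exact (Set.countable_iUnion fun n => Set.countable_range _).mono this

lemma eq_true_of_fBin_eq_one {b : ℕ → Bool} (h : fBin b = 1) (n : ℕ) : b n = true := by
  have head : ∀ {a : ℕ → Bool}, fBin a = 1 → a 0 = true ∧ fBin (fun n => a (n + 1)) = 1 := by
    intro a ha
    have h1 := fBin_le_one fun n => a (n + 1)
    rw [fBin_eq_head_tail] at ha
    cases h0 : a 0 with
    | false => norm_num [h0] at ha; linarith
    | true => norm_num [h0] at ha; exact ⟨rfl, by linarith⟩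
  induction n generalizing b with
  | zero => exact (head h).1
  | succ n ih => exact ih (head h).2

lemma tail_notMem_eventuallyTrue {b : ℕ → Bool} (hb : b ∉ EventuallyTrue) :
    (fun n => b (n + 1)) ∉ EventuallyTrue := by
  rintro ⟨n, hn⟩
  refine hb ⟨n + 1, fun k hk => ?_⟩
  obtain ⟨k, rfl⟩ : ∃ j, k = j + 1 := ⟨k - 1, by omega⟩
  exact hn k (by omega)

lemma fBin_lt_one {b : ℕ → Bool} (hb : b ∉ EventuallyTrue) : fBin b < 1 :=
  (fBin_le_one b).lt_of_ne fun h => hb ⟨0, fun k _ => eq_true_of_fBin_eq_one h k⟩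

lemma head_eq_of_fBin_eq {a b : ℕ → Bool} (ha : a ∉ EventuallyTrue) (hb : b ∉ EventuallyTrue)
    (h : fBin a = fBin b) : a 0 = b 0 := by
  have ha0 := fBin_nonneg fun n => a (n + 1)
  have hb0 := fBin_nonneg fun n => b (n + 1)
  have ha1 := fBin_lt_one (tail_notMem_eventuallyTrue ha)
  have hb1 := fBin_lt_one (tail_notMem_eventuallyTrue hb)
  rw [fBin_eq_head_tail a, fBin_eq_head_tail b] at h
  cases h1 : a 0 <;> cases h2 : b 0 <;> norm_num [h1, h2] at h ⊢ <;> linarith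

lemma injOn_fBin : Set.InjOn fBin EventuallyTrueᶜ := by
  intro a ha b hb h
  ext n
  induction n generalizing a b with
  | zero => rw [head_eq_of_fBin_eq ha hb h]
  | succ n ih =>
    refine ih (tail_notMem_eventuallyTrue ha) (tail_notMem_eventuallyTrue hb) ?_
    have h0 := head_eq_of_fBin_eq ha hb h
    rw [fBin_eq_head_tail a, fBin_eq_head_tail b, h0] at h
    linarith

instance : PolishSpace Bool :=
  (Topology.IsClosedEmbedding.of_continuous_injective_isClosedMap
    (f := fun c : Bool => if c then (1 : ℝ) else 0) continuous_of_discreteTopology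
    (fun a b h => by cases a <;> cases b <;> simp_all)
    fun s _ => (s.toFinite.image _).isClosed).polishSpace

lemma measurableSet_image_fBin {S : Set (ℕ → Bool)} (hS : MeasurableSet S) :
    MeasurableSet (fBin '' S) := by
  rw [← Set.sdiff_union_inter S EventuallyTrue, Set.image_union]
  refine MeasurableSet.union ?_ ?_
  · exact (hS.diff countable_eventuallyTrue.measurableSet).image_of_continuousOn_injOn
      continuous_fBin.continuousOn (injOn_fBin.mono fun _ h => h.2)
  · exact ((countable_eventuallyTrue.mono Set.inter_subset_right).image _).measurableSet

lemma fairCoin_eventuallyTrue : fairCoin EventuallyTrue = 0 := by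
  have hc := countable_eventuallyTrue.image fBin
  refine measure_mono_null (Set.subset_preimage_image fBin _) ?_
  rw [← volume_eq_fairCoin_preimage hc.measurableSet, hc.measure_zero]
  rintro _ ⟨b, -, rfl⟩
  exact ⟨fBin_nonneg b, fBin_le_one b⟩

/-- Lebesgue measure of the values of a set of binary sequences is the probability of the set. -/
lemma volume_image_fBin {S : Set (ℕ → Bool)} (hS : MeasurableSet S) :
    volume (fBin '' S) = fairCoin S := by
  rw [volume_eq_fairCoin_preimage (measurableSet_image_fBin hS)
    (by rintro _ ⟨b, -, rfl⟩; exact ⟨fBin_nonneg b, fBin_le_one b⟩)]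
  refine le_antisymm ?_ (measure_mono (Set.subset_preimage_image _ _))
  have hsub : fBin ⁻¹' (fBin '' S) ⊆
      S ∪ EventuallyTrue ∪ fBin ⁻¹' (fBin '' EventuallyTrue) := by
    rintro b ⟨a, ha, hab⟩
    by_cases hb : b ∈ EventuallyTrue
    · exact Or.inl (Or.inr hb)
    by_cases ha' : a ∈ EventuallyTrue
    · exact Or.inr ⟨a, ha', hab⟩
    · exact Or.inl (Or.inl (injOn_fBin ha' hb hab ▸ ha))
  have hc := countable_eventuallyTrue.image fBin
  have hnull : fairCoin (fBin ⁻¹' (fBin '' EventuallyTrue)) = 0 := by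
    rw [← volume_eq_fairCoin_preimage hc.measurableSet, hc.measure_zero]
    rintro _ ⟨b, -, rfl⟩
    exact ⟨fBin_nonneg b, fBin_le_one b⟩
  calc fairCoin (fBin ⁻¹' (fBin '' S))
      ≤ fairCoin S + fairCoin EventuallyTrue +
          fairCoin (fBin ⁻¹' (fBin '' EventuallyTrue)) :=
        (measure_mono hsub).trans ((measure_union_le _ _).trans
          (add_le_add_left (measure_union_le _ _) _))
    _ = fairCoin S := by rw [fairCoin_eventuallyTrue, hnull, add_zero, add_zero]

/-- The `i`-th bit, centred at its mean. -/
def centredBit (i : ℕ) (b : ℕ → Bool) : ℝ := (if b i then 1 else 0) - 1 / 2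

lemma measurable_centredBit (i : ℕ) : Measurable (centredBit i) :=
  (measurable_of_countable fun c : Bool => (if c then (1 : ℝ) else 0) - 1 / 2).comp
    (measurable_pi_apply i)

lemma abs_centredBit (i : ℕ) (b : ℕ → Bool) : |centredBit i b| = 1 / 2 := by
  unfold centredBit
  split_ifs <;> norm_num [abs_of_pos]

lemma integrable_centredBit (i : ℕ) : Integrable (centredBit i) fairCoin :=
  Integrable.of_bound (measurable_centredBit i).aestronglyMeasurable (1 / 2)
    (ae_of_all _ fun b => (abs_centredBit i b).le)

lemma iIndepFun_centredBit : iIndepFun centredBit fairCoin :=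
  iIndepFun_infinitePi (P := fun _ : ℕ => fairBit)
    (X := fun _ (c : Bool) => (if c then (1 : ℝ) else 0) - 1 / 2)
    fun _ => measurable_of_countable _

lemma identDistrib_centredBit (i j : ℕ) :
    IdentDistrib (centredBit i) (centredBit j) fairCoin fairCoin := by
  have h : IdentDistrib (fun b : ℕ → Bool => b i) (fun b => b j) fairCoin fairCoin :=
    ⟨(measurable_pi_apply i).aemeasurable, (measurable_pi_apply j).aemeasurable, by
      rw [fairCoin, Measure.infinitePi_map_eval, Measure.infinitePi_map_eval]⟩
  exact h.comp (measurable_of_countable fun c : Bool => (if c then (1 : ℝ) else 0) - 1 / 2)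

lemma integral_centredBit (i : ℕ) : ∫ b, centredBit i b ∂fairCoin = 0 := by
  have hmap : fairCoin.map (fun b => b i) = fairBit := by
    rw [fairCoin, Measure.infinitePi_map_eval]
  have : ∫ b, centredBit i b ∂fairCoin =
      ∫ c : Bool, ((if c then (1 : ℝ) else 0) - 1 / 2) ∂fairBit := by
    rw [← hmap, integral_map (measurable_pi_apply i).aemeasurable
      (measurable_of_countable _).aestronglyMeasurable]
    rfl
  rw [this, fairBit, integral_smul_measure, integral_add_measure .of_finite .of_finite]
  norm_num

lemma sum_centredBit (n : ℕ) (b : ℕ → Bool) :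
    ∑ i ∈ Finset.range n, centredBit i b = wPre b n - n * (1 / 2) := by
  simp [centredBit, wPre, Finset.sum_sub_distrib]

/-- Strong law of large numbers for fair bits. -/
lemma ae_tendsto_sum_centredBit_div :
    ∀ᵐ b ∂fairCoin, Tendsto (fun n : ℕ => ((wPre b n : ℝ) - n * (1 / 2)) / n) atTop (𝓝 0) := by
  have := strong_law_ae_real centredBit (integrable_centredBit 0)
    (fun i j hij => iIndepFun_centredBit.indepFun hij) fun i => identDistrib_centredBit i 0
  simpa only [integral_centredBit, sum_centredBit] using this

lemma martingale_sum_centredBit :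
    Martingale (fun n b => ∑ i ∈ Finset.range (n + 1), centredBit i b)
      (Filtration.natural centredBit fun i => (measurable_centredBit i).stronglyMeasurable)
      fairCoin := by
  set F := Filtration.natural centredBit fun i => (measurable_centredBit i).stronglyMeasurable
  have hadp : StronglyAdapted F fun n b => ∑ i ∈ Finset.range (n + 1), centredBit i b :=
    fun n => Finset.stronglyMeasurable_fun_sum _ fun i hi =>
      (Filtration.stronglyAdapted_natural _ i).mono (F.mono (by simp at hi; omega))
  have hint : ∀ n, Integrable (fun b => ∑ i ∈ Finset.range (n + 1), centredBit i b) fairCoin :=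
    fun n => integrable_finsetSum _ fun i _ => integrable_centredBit i
  refine martingale_nat hadp hint fun n => ?_
  have hsplit : (fun b => ∑ i ∈ Finset.range (n + 1 + 1), centredBit i b) =
      (fun b => ∑ i ∈ Finset.range (n + 1), centredBit i b) + centredBit (n + 1) := by
    ext b
    simp [Finset.sum_range_succ]
  rw [hsplit]
  filter_upwards [condExp_add (hint n) (integrable_centredBit (n + 1)) (F n),
    iIndepFun_centredBit.condExp_natural_ae_eq_of_lt
      (fun i => (measurable_centredBit i).stronglyMeasurable) n.lt_succ_self] with b h1 h2
  rw [h1, Pi.add_apply, condExp_of_stronglyMeasurable (F.le n) (hadp n) (hint n)]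
  have h3 : (fairCoin[centredBit (n + 1)|F n]) b = 0 := h2.trans (integral_centredBit _)
  rw [h3, add_zero]

lemma measurableSet_heavy (ρ : ℝ) : MeasurableSet {b | Heavy ρ b} := by
  refine measurableSet_le measurable_const (Measurable.liminf fun n => ?_)
  refine measurable_coe_real_ereal.comp (Measurable.sub_const ?_ _)
  have : (fun b => (wPre b n : ℝ)) =
      fun b => ∑ i ∈ Finset.range n, centredBit i b + n * (1 / 2) := by
    ext b
    rw [sum_centredBit, sub_add_cancel]
  rw [this]
  exact (Finset.measurable_fun_sum _ fun i _ => measurable_centredBit i).add_const _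

lemma Heavy.anti {ρ σ : ℝ} (h : ρ ≤ σ) {b : ℕ → Bool} (hb : Heavy σ b) : Heavy ρ b := by
  refine le_trans hb (liminf_le_liminf (Eventually.of_forall fun n => ?_))
  exact EReal.coe_le_coe (by gcongr)

lemma ae_heavy_of_lt_half {ρ : ℝ} (hρ : ρ < 1 / 2) : ∀ᵐ b ∂fairCoin, Heavy ρ b := by
  filter_upwards [ae_tendsto_sum_centredBit_div] with b hb
  refine le_liminf_of_le (by isBoundedDefault) ?_
  filter_upwards [hb.eventually_const_lt (show ρ - 1 / 2 < 0 by linarith),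
    eventually_gt_atTop 0] with n hn hn0
  have hn0' : (0 : ℝ) < n := by exact_mod_cast hn0
  rw [lt_div_iff₀ hn0'] at hn
  exact EReal.coe_nonneg.2 (by linarith)

lemma ae_not_heavy_half : ∀ᵐ b ∂fairCoin, ¬ Heavy (1 / 2) b := by
  have hstep : ∀ (b : ℕ → Bool) (n : ℕ), ∑ i ∈ Finset.range (n + 1 + 1), centredBit i b -
      ∑ i ∈ Finset.range (n + 1), centredBit i b = centredBit (n + 1) b := fun b n => by
    rw [Finset.sum_range_succ, add_sub_cancel_left]
  have hbdd : ∀ᵐ b ∂fairCoin, ∀ n, |∑ i ∈ Finset.range (n + 1 + 1), centredBit i b -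
      ∑ i ∈ Finset.range (n + 1), centredBit i b| ≤ ((1 / 2 : NNReal) : ℝ) :=
    ae_of_all _ fun b n => by rw [hstep, abs_centredBit]; norm_num
  filter_upwards [martingale_sum_centredBit.bddAbove_range_iff_bddBelow_range hbdd,
    martingale_sum_centredBit.submartingale.bddAbove_iff_exists_tendsto hbdd] with b h1 h2 hb
  have hlow : ∀ᶠ n : ℕ in atTop, (-1 : ℝ) ≤ wPre b n - n * (1 / 2) := by
    have hlt : ((-1 : ℝ) : EReal) <
        atTop.liminf fun n : ℕ => (((wPre b n : ℝ) - n * (1 / 2) : ℝ) : EReal) :=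
      lt_of_lt_of_le (EReal.coe_neg'.2 (by norm_num)) hb
    filter_upwards [eventually_lt_of_lt_liminf hlt] with n hn
    exact (EReal.coe_lt_coe_iff.1 hn).le
  have hbelow : BddBelow (Set.range fun n => ∑ i ∈ Finset.range (n + 1), centredBit i b) := by
    refine IsBoundedUnder.bddBelow_range ⟨-1, eventually_map.2 ?_⟩
    filter_upwards [(tendsto_add_atTop_nat 1).eventually hlow] with n hn
    rw [sum_centredBit]
    exact hn
  obtain ⟨c, hc⟩ := h2.1 (h1.2 hbelow)
  have hzero := ((hc.comp (tendsto_add_atTop_nat 1)).sub hc).abs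
  have hhalf : Tendsto (fun _ : ℕ => (1 / 2 : ℝ)) atTop (𝓝 |c - c|) :=
    hzero.congr fun n => by rw [Function.comp_apply, hstep, abs_centredBit]
  have := tendsto_nhds_unique hhalf tendsto_const_nhds
  norm_num at this

/-- `H(ρ)` is Lebesgue measurable with `λ(H(ρ)) = 1` if `ρ < 1/2` and `λ(H(ρ)) = 0`
if `ρ ≥ 1/2`. -/
theorem heavy_lebesgue_measure (ρ : ℝ) (hρ : ρ ∈ Set.Icc (0 : ℝ) 1) :
    MeasurableSet (Hset ρ) ∧
    volume (Hset ρ) = (if ρ < 1 / 2 then (1 : ENNReal) else 0) := by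
  have himage : Hset ρ = fBin '' {b | Heavy ρ b} := by
    ext x
    exact ⟨fun ⟨b, hx, hb⟩ => ⟨b, hb, hx⟩, fun ⟨b, hb, hx⟩ => ⟨b, hx, hb⟩⟩
  rw [himage, volume_image_fBin (measurableSet_heavy ρ)]
  refine ⟨measurableSet_image_fBin (measurableSet_heavy ρ), ?_⟩
  split_ifs with h
  · exact (mem_ae_iff_prob_eq_one (measurableSet_heavy ρ)).1 (ae_heavy_of_lt_half h)
  · refine measure_mono_null (fun b hb => Heavy.anti (not_lt.1 h) hb) (t := {b | Heavy (1 / 2) b}) ?_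
    simpa [ae_iff] using ae_not_heavy_half
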